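/- Let (X, B, μ) be a probability space and T : X → X an invertible measure-preserving transformation. Then for any A ∈ B with μ(A) > 0, the limit lim_{N−M→∞} (1/(N−M)²) Σ_{n=M}^{N−1} Σ_{m=M}^{N−1} μ(A ∩ TⁿA ∩ TᵐA ∩ T^{n+m}A) exists and is at least μ(A)⁴. -/

import Mathlib

open MeasureTheory Filter
open scoped Topology RealInnerProductSpace

/-- The average of `x` over the integer window `[p.1, p.2)`. -/
noncomputable def windowAverage {E : Type*} [AddCommGroup E] [Module ℝ E] (p : ℤ × ℤ)
    (x : ℤ → E) : E :=
  ((p.2 : ℝ) - p.1)⁻¹ • ∑ n ∈ Finset.Ico p.1 p.2, x n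

/-- The filter on integer windows `[p.1, p.2)` whose length tends to infinity. -/
noncomputable def windowFilter : Filter (ℤ × ℤ) := comap (fun p => p.2 - p.1) atTop

theorem eventually_windowFilter {P : ℤ × ℤ → Prop} :
    (∀ᶠ p in windowFilter, P p) ↔ ∃ K : ℕ, ∀ p : ℤ × ℤ, (K : ℤ) ≤ p.2 - p.1 → P p := by
  rw [windowFilter, eventually_comap, eventually_atTop]
  constructor
  · rintro ⟨a, ha⟩
    exact ⟨a.toNat, fun p hp => ha (p.2 - p.1) (by omega) p rfl⟩
  · rintro ⟨K, hK⟩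
    exact ⟨K, fun b hb p hp => hK p (by omega)⟩

theorem tendsto_windowFilter_sub : Tendsto (fun p : ℤ × ℤ => p.2 - p.1) windowFilter atTop :=
  tendsto_comap

instance neBot_windowFilter : NeBot windowFilter :=
  Filter.NeBot.comap_of_surj inferInstance fun n => ⟨(0, n), by simp⟩

theorem eventually_lt_windowFilter : ∀ᶠ p : ℤ × ℤ in windowFilter, p.1 < p.2 :=
  eventually_windowFilter.2 ⟨1, fun p hp => by omega⟩

theorem tendsto_inv_length :
    Tendsto (fun p : ℤ × ℤ => ((p.2 : ℝ) - p.1)⁻¹) windowFilter (𝓝 0) := by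
  refine tendsto_inv_atTop_zero.comp ?_
  simpa [Function.comp_def] using
    (tendsto_intCast_atTop_atTop (R := ℝ)).comp tendsto_windowFilter_sub

theorem natCast_toNat_length {p : ℤ × ℤ} (hp : p.1 ≤ p.2) :
    (((p.2 - p.1).toNat : ℕ) : ℝ) = (p.2 : ℝ) - p.1 := by
  rw [← Int.cast_natCast, Int.toNat_of_nonneg (by omega), Int.cast_sub]

section Algebra

variable {E : Type*} [AddCommGroup E] [Module ℝ E] (p : ℤ × ℤ)

theorem windowAverage_add (x y : ℤ → E) :
    windowAverage p (fun n => x n + y n) = windowAverage p x + windowAverage p y := by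
  simp [windowAverage, Finset.sum_add_distrib]

theorem windowAverage_sub (x y : ℤ → E) :
    windowAverage p (fun n => x n - y n) = windowAverage p x - windowAverage p y := by
  simp [windowAverage, Finset.sum_sub_distrib, smul_sub]

theorem windowAverage_sum {ι : Type*} (s : Finset ι) (x : ι → ℤ → E) :
    windowAverage p (fun n => ∑ i ∈ s, x i n) = ∑ i ∈ s, windowAverage p (x i) := by
  simp only [windowAverage]
  rw [Finset.sum_comm, Finset.smul_sum]

theorem LinearMap.map_windowAverage {F : Type*} [AddCommGroup F] [Module ℝ F] (f : E →ₗ[ℝ] F)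
    (x : ℤ → E) : f (windowAverage p x) = windowAverage p (fun n => f (x n)) := by
  simp [windowAverage]

theorem windowAverage_smul (c : ℝ) (x : ℤ → E) :
    windowAverage p (fun n => c • x n) = c • windowAverage p x := by
  simp only [windowAverage, ← Finset.smul_sum]
  rw [smul_comm]

theorem windowAverage_const_mul (c : ℝ) (x : ℤ → ℝ) :
    windowAverage p (fun n => c * x n) = c * windowAverage p x :=
  windowAverage_smul p c x

theorem windowAverage_comm (q : ℤ × ℤ) (x : ℤ → ℤ → E) :
    windowAverage p (fun n => windowAverage q fun m => x n m) =
      windowAverage q (fun m => windowAverage p fun n => x n m) := by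
  simp only [windowAverage, ← Finset.smul_sum]
  rw [Finset.sum_comm, smul_comm]

theorem windowAverage_comp_add (k : ℤ) (x : ℤ → E) :
    windowAverage p (fun n => x (n + k)) = windowAverage (p.1 + k, p.2 + k) x := by
  simp only [windowAverage]
  rw [← Finset.map_add_right_Ico, Finset.sum_map]
  simp

variable {p}

theorem windowAverage_const (hp : p.1 < p.2) (c : E) : windowAverage p (fun _ => c) = c := by
  have h : ((p.2 : ℝ) - p.1) ≠ 0 := by
    have : (p.1 : ℝ) < p.2 := by exact_mod_cast hp
    linarith
  simp only [windowAverage, Finset.sum_const, Int.card_Ico]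
  rw [← Nat.cast_smul_eq_nsmul ℝ, natCast_toNat_length hp.le, smul_smul, inv_mul_cancel₀ h, one_smul]

end Algebra

theorem inv_length_nonneg (p : ℤ × ℤ) (hp : p.1 ≤ p.2) : 0 ≤ ((p.2 : ℝ) - p.1)⁻¹ := by
  have : (p.1 : ℝ) ≤ p.2 := by exact_mod_cast hp
  exact inv_nonneg.2 (by linarith)

theorem windowAverage_mono (p : ℤ × ℤ) {x y : ℤ → ℝ} (h : ∀ n, x n ≤ y n) :
    windowAverage p x ≤ windowAverage p y := by
  rcases le_or_gt p.1 p.2 with hp | hp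
  · exact smul_le_smul_of_nonneg_left (Finset.sum_le_sum fun n _ => h n) (inv_length_nonneg p hp)
  · simp [windowAverage, Finset.Ico_eq_empty_of_le hp.le]

theorem windowAverage_nonneg (p : ℤ × ℤ) {x : ℤ → ℝ} (h : ∀ n, 0 ≤ x n) :
    0 ≤ windowAverage p x := by
  simpa [windowAverage] using windowAverage_mono p h

theorem norm_windowAverage_le {E : Type*} [SeminormedAddCommGroup E] [NormedSpace ℝ E]
    (p : ℤ × ℤ) (x : ℤ → E) : ‖windowAverage p x‖ ≤ windowAverage p (fun n => ‖x n‖) := by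
  rcases le_or_gt p.1 p.2 with hp | hp
  · rw [windowAverage, norm_smul, Real.norm_of_nonneg (inv_length_nonneg p hp)]
    exact mul_le_mul_of_nonneg_left (norm_sum_le _ _) (inv_length_nonneg p hp)
  · simp [windowAverage, Finset.Ico_eq_empty_of_le hp.le]

theorem norm_windowAverage_le_of_le {E : Type*} [SeminormedAddCommGroup E] [NormedSpace ℝ E]
    {p : ℤ × ℤ} (hp : p.1 < p.2) {x : ℤ → E} {C : ℝ} (hx : ∀ n, ‖x n‖ ≤ C) :
    ‖windowAverage p x‖ ≤ C :=
  (norm_windowAverage_le p x).trans <|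
    (windowAverage_mono p hx).trans (windowAverage_const hp C).le

theorem norm_windowAverage_succ_sub_le {E : Type*} [SeminormedAddCommGroup E] [NormedSpace ℝ E]
    {p : ℤ × ℤ} (hp : p.1 ≤ p.2) {x : ℤ → E} {C : ℝ} (hx : ∀ n, ‖x n‖ ≤ C) :
    ‖windowAverage p (fun n => x (n + 1)) - windowAverage p x‖ ≤
      2 * C * ((p.2 : ℝ) - p.1)⁻¹ := by
  have key : ∑ n ∈ Finset.Ico p.1 p.2, (x (n + 1) - x n) = x p.2 - x p.1 := by
    obtain ⟨a, b⟩ := p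
    induction b, hp using Int.leInduction with
    | base => simp
    | succ b hb ih =>
      dsimp only at hb ih ⊢
      rw [← Finset.insert_Ico_right_eq_Ico_add_one hb, Finset.sum_insert (by simp), ih]
      abel
  rw [← windowAverage_sub, windowAverage, key, norm_smul,
    Real.norm_of_nonneg (inv_length_nonneg p hp), mul_comm]
  refine mul_le_mul_of_nonneg_right ?_ (inv_length_nonneg p hp)
  linarith [norm_sub_le (x p.2) (x p.1), hx p.1, hx p.2]

theorem norm_windowAverage_add_nat_sub_le {E : Type*} [SeminormedAddCommGroup E]
    [NormedSpace ℝ E] {p : ℤ × ℤ} (hp : p.1 ≤ p.2) {x : ℤ → E} {C : ℝ} (hx : ∀ n, ‖x n‖ ≤ C)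
    (k : ℕ) :
    ‖windowAverage p (fun n => x (n + k)) - windowAverage p x‖ ≤
      k * (2 * C * ((p.2 : ℝ) - p.1)⁻¹) := by
  induction k with
  | zero => simp
  | succ k ih =>
    have h := norm_windowAverage_succ_sub_le hp (x := fun n => x (n + k)) (fun n => hx _)
    have e : (fun n : ℤ => x (n + (k + 1 : ℕ))) = fun n => x (n + 1 + k) := by
      funext n; congr 1; push_cast; ring
    rw [e]
    have := norm_sub_le_norm_sub_add_norm_sub (windowAverage p fun n => x (n + 1 + k))
      (windowAverage p fun n => x (n + k)) (windowAverage p x)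
    push_cast
    linarith

theorem norm_windowAverage_add_int_sub_le {E : Type*} [SeminormedAddCommGroup E]
    [NormedSpace ℝ E] {p : ℤ × ℤ} (hp : p.1 ≤ p.2) {x : ℤ → E} {C : ℝ} (hx : ∀ n, ‖x n‖ ≤ C)
    (k : ℤ) :
    ‖windowAverage p (fun n => x (n + k)) - windowAverage p x‖ ≤
      k.natAbs * (2 * C * ((p.2 : ℝ) - p.1)⁻¹) := by
  rcases Int.natAbs_eq k with h | h
  · conv_lhs => rw [h]
    exact norm_windowAverage_add_nat_sub_le hp hx _
  · have := norm_windowAverage_add_nat_sub_le hp (x := fun n => x (n + k)) (fun n => hx _)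
      k.natAbs
    have e : (fun n => x (n + k.natAbs + k)) = x := by
      funext n; congr 1; omega
    rwa [e, norm_sub_rev] at this

theorem tendsto_windowAverage_add_sub {E : Type*} [SeminormedAddCommGroup E]
    [NormedSpace ℝ E] {x : ℤ → E} {C : ℝ} (hx : ∀ n, ‖x n‖ ≤ C) (k : ℤ) :
    Tendsto (fun p => windowAverage p (fun n => x (n + k)) - windowAverage p x)
      windowFilter (𝓝 0) := by
  refine squeeze_zero_norm' (eventually_lt_windowFilter.mono fun p hp =>
    norm_windowAverage_add_int_sub_le hp.le hx k) ?_
  simpa using ((tendsto_inv_length.const_mul (2 * C)).const_mul (k.natAbs : ℝ))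

theorem windowAverage_map_windowAverage {V : Type*} [AddCommGroup V] [Module ℝ V]
    (B : V →ₗ[ℝ] V →ₗ[ℝ] ℝ) (e : ℤ → V) (p q : ℤ × ℤ) :
    B (windowAverage p e) (windowAverage q e) =
      windowAverage p (fun k => windowAverage q (fun l => B (e k) (e l))) := by
  have h := LinearMap.map_windowAverage p (B.flip (windowAverage q e)) e
  simp only [LinearMap.flip_apply] at h
  rw [h]
  congr 1
  funext k
  exact LinearMap.map_windowAverage q (B (e k)) e

/-- A positive definite sequence has a uniform Cesàro limit. -/
theorem exists_tendsto_windowAverage_of_posDef {V : Type*} [AddCommGroup V] [Module ℝ V]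
    (B : V →ₗ[ℝ] V →ₗ[ℝ] ℝ) (hsymm : ∀ x y, B x y = B y x) (hpos : ∀ x, 0 ≤ B x x)
    (e : ℤ → V) (b : ℤ → ℝ) (hB : ∀ k l, B (e k) (e l) = b (l - k)) {C : ℝ}
    (hb : ∀ n, ‖b n‖ ≤ C) :
    ∃ β : ℝ, Tendsto (fun p => windowAverage p b) windowFilter (𝓝 β) := by
  set a : ℤ × ℤ → ℝ := fun p => windowAverage p b with ha
  set A : ℤ × ℤ → V := fun p => windowAverage p e with hA
  have habs : ∀ᶠ p in windowFilter, |a p| ≤ C :=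
    eventually_lt_windowFilter.mono fun p hp => norm_windowAverage_le_of_le hp hb
  have hbdd : windowFilter.IsBoundedUnder (· ≤ ·) a :=
    ⟨C, eventually_map.2 (habs.mono fun p hp => (abs_le.1 hp).2)⟩
  have hcobdd : windowFilter.IsCoboundedUnder (· ≤ ·) a :=
    (show windowFilter.IsBoundedUnder (· ≥ ·) a from
      ⟨-C, eventually_map.2 (habs.mono fun p hp => (abs_le.1 hp).1)⟩).isCoboundedUnder_le
  set s := limsup a windowFilter with hs
  have hBA : ∀ p q, B (A p) (A q) =
      windowAverage p (fun k => windowAverage q (fun l => b (l + -k))) := fun p q => by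
    simp only [hA, windowAverage_map_windowAverage, hB, sub_eq_add_neg]
  have hBe : ∀ q, B (e 0) (A q) = a q := fun q => by
    simp only [hA, ha, LinearMap.map_windowAverage, hB, sub_zero]
  have hupper : ∀ ε > 0, ∃ K : ℕ, ∀ q : ℤ × ℤ, (K : ℤ) ≤ q.2 - q.1 →
      q.1 < q.2 ∧ a q ≤ s + ε ∧ B (A q) (A q) ≤ s + ε := by
    intro ε hε
    obtain ⟨K, hK⟩ := eventually_windowFilter.1
      ((eventually_lt_of_limsup_lt (show limsup a windowFilter < s + ε by linarith) hbdd).and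
        eventually_lt_windowFilter)
    refine ⟨K, fun q hq => ⟨(hK q hq).2, (hK q hq).1.le, ?_⟩⟩
    rw [hBA, ← windowAverage_const (hK q hq).2 (s + ε)]
    refine windowAverage_mono q fun k => ?_
    rw [windowAverage_comp_add]
    exact (hK (q.1 + -k, q.2 + -k) (by simpa using hq)).1.le
  have hfreq : ∀ ε > 0, ∃ᶠ q in windowFilter, s - ε < a q := fun ε hε =>
    frequently_lt_of_lt_limsup hcobdd (by linarith)
  have hlim : ∀ p : ℤ × ℤ, p.1 < p.2 →
      Tendsto (fun q => B (A p) (A q) - a q) windowFilter (𝓝 0) := by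
    intro p hp
    have h1 : ∀ q, B (A p) (A q) - a q =
        windowAverage p (fun k => windowAverage q (fun l => b (l + -k)) - windowAverage q b) := by
      intro q
      rw [hBA, windowAverage_sub, windowAverage_const hp]
    simp only [h1]
    have := (tendsto_finsetSum (Finset.Ico p.1 p.2) fun k _ =>
      tendsto_windowAverage_add_sub hb (-k)).const_smul ((p.2 : ℝ) - p.1)⁻¹
    simpa [windowAverage] using this
  have hlower : ∀ p p' : ℤ × ℤ, p.1 < p.2 → p'.1 < p'.2 →
      s ≤ B ((1 / 2 : ℝ) • (A p + A p')) ((1 / 2 : ℝ) • (A p + A p')) := by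
    intro p p' hp hp'
    set x := (1 / 2 : ℝ) • (A p + A p') with hx
    refine le_of_forall_pos_le_add fun ε hε => ?_
    obtain ⟨K, hK⟩ := hupper (ε / 6) (by linarith)
    have h1 := (Metric.tendsto_nhds.1 (hlim p hp) (ε / 6) (by linarith)).and
      (Metric.tendsto_nhds.1 (hlim p' hp') (ε / 6) (by linarith))
    obtain ⟨q, h2, ⟨h3, h4⟩, h5⟩ := ((hfreq (ε / 6) (by linarith)).and_eventually
      (h1.and (eventually_windowFilter.2 ⟨K, hK⟩))).exists
    rw [Real.dist_eq, sub_zero, abs_lt] at h3 h4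
    have h6 : B x (A q) = (1 / 2) * (B (A p) (A q) + B (A p') (A q)) := by
      simp [hx]; ring
    have h7 := hpos (x - A q)
    simp only [map_sub, LinearMap.sub_apply] at h7
    rw [hsymm (A q) x] at h7
    linarith [h5.2.2, h3.1, h4.1]
  refine ⟨s, Metric.tendsto_nhds.2 fun η hη => ?_⟩
  have hC : 0 ≤ C := (norm_nonneg _).trans (hb 0)
  set ε := min (η / 3) (η ^ 2 / (36 * (C + 1))) with hε
  have hε0 : 0 < ε := lt_min (by linarith) (by positivity)
  obtain ⟨K, hK⟩ := hupper ε hε0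
  obtain ⟨p', hp'1, hp'2⟩ := ((hfreq ε hε0).and_eventually
    (eventually_windowFilter.2 ⟨K, hK⟩)).exists
  refine eventually_windowFilter.2 ⟨K, fun p hp => ?_⟩
  obtain ⟨h1, h2, h3⟩ := hK p hp
  have hQ : B (A p - A p') (A p - A p') ≤ 4 * ε := by
    have h4 := hlower p p' h1 hp'2.1
    simp only [map_smul, map_add, LinearMap.add_apply, LinearMap.smul_apply, smul_eq_mul] at h4
    simp only [map_sub, LinearMap.sub_apply]
    rw [hsymm (A p') (A p)] at h4 ⊢
    linarith [hp'2.2.2]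
  have hCS : (a p - a p') ^ 2 ≤ C * (4 * ε) := by
    have h5 := LinearMap.BilinForm.apply_mul_apply_le_of_forall_zero_le B hpos (e 0) (A p - A p')
    rw [hsymm _ (e 0), map_sub, hBe, hBe, hB, ← sq] at h5
    refine h5.trans ?_
    have h6 : b (0 - 0) ≤ C := (le_abs_self _).trans (hb _)
    calc b (0 - 0) * B (A p - A p') (A p - A p') ≤ C * B (A p - A p') (A p - A p') :=
          mul_le_mul_of_nonneg_right h6 (hpos _)
      _ ≤ C * (4 * ε) := mul_le_mul_of_nonneg_left hQ hC
  have hε1 : ε ≤ η / 3 := min_le_left _ _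
  have hε2 : (C + 1) * (36 * ε) ≤ η ^ 2 := by
    have h7 : ε ≤ η ^ 2 / (36 * (C + 1)) := min_le_right _ _
    rw [le_div_iff₀ (by positivity)] at h7
    linarith
  have h8 : |a p - a p'| < η / 2 := abs_lt_of_sq_lt_sq (by nlinarith) (by linarith)
  rw [Real.dist_eq, abs_lt]
  rw [abs_lt] at h8
  constructor <;> linarith

section Hilbert

variable {H : Type*} [NormedAddCommGroup H] [InnerProductSpace ℝ H]

theorem windowAverage_orbit_eq {U : ℤ → H →ₗᵢ[ℝ] H} (h0 : ∀ x, U 0 x = x)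
    (hadd : ∀ n m x, U (n + m) x = U n (U m x)) (x : H) (p : ℤ × ℤ) (hp : p.1 ≤ p.2) :
    windowAverage p (fun n => U n x) =
      U p.1 (birkhoffAverage ℝ (U 1).toContinuousLinearMap _root_.id (p.2 - p.1).toNat x) := by
  have hiter : ∀ n : ℕ, (U 1).toContinuousLinearMap^[n] x = U n x := by
    intro n
    induction n with
    | zero => simp [h0]
    | succ n ih =>
      rw [Function.iterate_succ_apply', ih]
      push_cast
      rw [add_comm, hadd]
      rfl
  simp only [birkhoffAverage, birkhoffSum, hiter, id, map_smul, map_sum, natCast_toNat_length hp, windowAverage,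
    ← hadd]
  congr 1
  refine Finset.sum_bij' (fun n _ => (n - p.1).toNat) (fun n _ => p.1 + n) ?_ ?_ ?_ ?_ ?_
  · intro n hn; simp only [Finset.mem_Ico, Finset.mem_range] at *; omega
  · intro n hn; simp only [Finset.mem_Ico, Finset.mem_range] at *; omega
  · intro n hn; simp only [Finset.mem_Ico] at *; omega
  · intro n hn; simp
  · intro n hn
    simp only [Finset.mem_Ico] at hn
    congr 2
    omega

/-- The mean ergodic theorem for a unitary `ℤ`-action, uniformly over windows. -/
theorem exists_invariant_projection [CompleteSpace H] {U : ℤ → H →ₗᵢ[ℝ] H}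
    (h0 : ∀ x, U 0 x = x) (hadd : ∀ n m x, U (n + m) x = U n (U m x)) :
    ∃ P : H → H, (∀ x, Tendsto (fun p => windowAverage p (fun n => U n x)) windowFilter
      (𝓝 (P x))) ∧ (∀ n x, U n (P x) = P x) ∧
      ∀ x y, (∀ n, U n y = y) → ⟪P x, y⟫ = ⟪x, y⟫ := by
  set f : H →L[ℝ] H := (U 1).toContinuousLinearMap with hf
  set K := f.eqLocus (1 : H →L[ℝ] H) with hK
  have hfix : ∀ y ∈ K, ∀ n, U n y = y := by
    intro y hy n
    have h1 : U 1 y = y := hy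
    induction n with
    | zero => exact h0 y
    | succ n ih => rw [hadd, h1, ih]
    | pred n ih =>
      have h2 := hadd (-n - 1) 1 y
      rw [sub_add_cancel, h1, ih] at h2
      exact h2.symm
  have hPfix : ∀ n x, U n (K.starProjection x) = K.starProjection x := fun n x =>
    hfix _ (K.starProjection_apply_mem x) n
  refine ⟨fun x => K.starProjection x, fun x => ?_, hPfix, fun x y hy => ?_⟩
  · have h1 := f.tendsto_birkhoffAverage_orthogonalProjection
      (U 1).norm_toContinuousLinearMap_le x
    have h2 : Tendsto (fun p : ℤ × ℤ => (p.2 - p.1).toNat) windowFilter atTop :=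
      (tendsto_atTop_atTop.2 fun n => ⟨n, fun a ha => by omega⟩ :
        Tendsto Int.toNat atTop atTop).comp tendsto_windowFilter_sub
    rw [tendsto_iff_norm_sub_tendsto_zero] at h1 ⊢
    refine (h1.comp h2).congr' (eventually_lt_windowFilter.mono fun p hp => ?_)
    change _ = ‖windowAverage p (fun n => U n x) - K.starProjection x‖
    rw [windowAverage_orbit_eq h0 hadd x p hp.le]
    conv_rhs => rw [← hPfix p.1 x, ← map_sub, (U p.1).norm_map]
    rfl
  · have hyK : y ∈ K := hy 1
    have := K.inner_starProjection_left_eq_right x y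
    rwa [K.starProjection_eq_self_iff.2 hyK] at this

theorem norm_windowAverage_orbit_sub_le {U : ℤ → H →ₗᵢ[ℝ] H}
    (hadd : ∀ n m x, U (n + m) x = U n (U m x)) {p q : ℤ × ℤ} (hp : p.1 < p.2)
    (hq : q.1 < q.2) (x y : H) (hy : ∀ n, U n y = y) :
    ‖windowAverage p (fun n => U n x) - y‖ ≤ ‖windowAverage q (fun n => U n x) - y‖ +
      windowAverage q (fun k => (k.natAbs : ℝ)) * (2 * ‖x‖ * ((p.2 : ℝ) - p.1)⁻¹) := by
  set w := windowAverage q (fun n => U n x) with hw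
  have h1 : ‖windowAverage p (fun n => U n w) - y‖ ≤ ‖w - y‖ := by
    have : windowAverage p (fun n => U n w) - y = windowAverage p (fun n => U n (w - y)) := by
      simp only [map_sub, windowAverage_sub, hy, windowAverage_const hp]
    rw [this]
    exact norm_windowAverage_le_of_le hp fun n => ((U n).norm_map _).le
  have h2 : windowAverage p (fun n => U n w) - windowAverage p (fun n => U n x) =
      windowAverage q (fun k => windowAverage p (fun n => U (n + k) x) -
        windowAverage p (fun n => U n x)) := by
    rw [windowAverage_sub, windowAverage_const hq, windowAverage_comm]
    congr 2
    funext n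
    rw [hw]
    simp only [hadd]
    exact LinearMap.map_windowAverage q (U n).toLinearMap _
  have h3 : ‖windowAverage p (fun n => U n w) - windowAverage p (fun n => U n x)‖ ≤
      windowAverage q (fun k => (k.natAbs : ℝ)) * (2 * ‖x‖ * ((p.2 : ℝ) - p.1)⁻¹) := by
    rw [h2, mul_comm, ← windowAverage_const_mul]
    refine (norm_windowAverage_le q _).trans (windowAverage_mono q fun k => ?_)
    rw [mul_comm]
    exact norm_windowAverage_add_int_sub_le hp.le (x := fun n => U n x)
      (fun n => ((U n).norm_map x).le) k
  have h4 := norm_sub_le_norm_sub_add_norm_sub (windowAverage p fun n => U n x)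
    (windowAverage p fun n => U n w) y
  rw [norm_sub_rev] at h3
  linarith

theorem exists_tendsto_double_windowAverage {U : ℤ → H →ₗᵢ[ℝ] H}
    (hadd : ∀ n m x, U (n + m) x = U n (U m x)) {P : H → H}
    (hP : ∀ x, Tendsto (fun p => windowAverage p (fun n => U n x)) windowFilter (𝓝 (P x)))
    (hPfix : ∀ n x, U n (P x) = P x) (hPinner : ∀ x y, (∀ n, U n y = y) → ⟪P x, y⟫ = ⟪x, y⟫)
    {g : ℤ → H} (hg : ∀ m, ‖g m‖ ≤ 1) (hgsymm : ∀ n m, ⟪g m, U n (g m)⟫ = ⟪g n, U m (g n)⟫) :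
    ∃ β : ℝ, Tendsto (fun p => windowAverage p (fun m => ‖P (g m)‖ ^ 2)) windowFilter (𝓝 β) ∧
      Tendsto (fun p => windowAverage p (fun n => windowAverage p (fun m => ⟪g m, U n (g m)⟫)))
        windowFilter (𝓝 β) := by
  set b : ℤ → ℝ := fun m => ‖P (g m)‖ ^ 2 with hb
  have hPg : ∀ m, ⟪g m, P (g m)⟫ = b m := fun m => by
    rw [hb, ← hPinner _ _ fun n => hPfix n _, real_inner_self_eq_norm_sq]
  have hblim : ∀ m, Tendsto (fun p => windowAverage p (fun n => ⟪g m, U n (g m)⟫)) windowFilter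
      (𝓝 (b m)) := fun m => by
    have h1 := (tendsto_const_nhds (x := g m)).inner (𝕜 := ℝ) (hP (g m))
    rw [hPg] at h1
    exact h1.congr fun p => LinearMap.map_windowAverage p (innerₗ H (g m)) _
  have hPnorm : ∀ m, ‖P (g m)‖ ≤ 1 := fun m =>
    le_of_tendsto (hP (g m)).norm (eventually_lt_windowFilter.mono fun p hp =>
      norm_windowAverage_le_of_le hp fun n => ((U n).norm_map _).trans_le (hg m))
  have hbbd : ∀ m, ‖b m‖ ≤ 1 := fun m => by
    rw [hb, norm_pow, norm_norm]
    exact pow_le_one₀ (norm_nonneg _) (hPnorm m)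
  set B : (ℤ →₀ ℝ) →ₗ[ℝ] (ℤ →₀ ℝ) →ₗ[ℝ] ℝ := Finsupp.linearCombination ℝ
    (fun k => Finsupp.linearCombination ℝ (fun l => b (l - k))) with hBdef
  set G : ℤ → (ℤ →₀ ℝ) →ₗ[ℝ] H := fun m => Finsupp.linearCombination ℝ (fun k => U k (g m))
    with hG
  have hGB : ∀ c d, Tendsto (fun p => windowAverage p (fun m => ⟪G m c, G m d⟫)) windowFilter
      (𝓝 (B c d)) := by
    intro c d
    induction c using Finsupp.induction_linear with
    | zero => simp [windowAverage]
    | add c c' hc hc' =>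
      simpa only [map_add, LinearMap.add_apply, inner_add_left, windowAverage_add] using
        hc.add hc'
    | single k x =>
      induction d using Finsupp.induction_linear with
      | zero => simp [windowAverage]
      | add d d' hd hd' =>
        simpa only [map_add, inner_add_right, windowAverage_add] using hd.add hd'
      | single l y =>
        have h1 : ∀ m, ⟪G m (Finsupp.single k x), G m (Finsupp.single l y)⟫ =
            x * y * ⟪g (l - k), U m (g (l - k))⟫ := by
          intro m
          have h2 : ⟪U k (g m), U l (g m)⟫ = ⟪g m, U (l - k) (g m)⟫ := by
            conv_lhs => rw [← add_sub_cancel k l, hadd, (U k).inner_map_map]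
          simp only [hG, Finsupp.linearCombination_single, real_inner_smul_left,
            real_inner_smul_right]
          rw [h2, hgsymm]
          ring
        simp only [h1, windowAverage_const_mul]
        simpa [hBdef, mul_assoc] using (hblim (l - k)).const_mul (x * y)
  have hsymm : ∀ c d, B c d = B d c := fun c d =>
    tendsto_nhds_unique (hGB c d) (by simpa only [real_inner_comm] using hGB d c)
  have hpos : ∀ c, 0 ≤ B c c := fun c =>
    ge_of_tendsto (hGB c c) (Eventually.of_forall fun p =>
      windowAverage_nonneg p fun m => real_inner_self_nonneg)
  have hBe : ∀ k l, B (Finsupp.single k 1) (Finsupp.single l 1) = b (l - k) := by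
    simp [hBdef]
  obtain ⟨β, hβ⟩ := exists_tendsto_windowAverage_of_posDef B hsymm hpos
    (fun k => Finsupp.single k 1) b hBe hbbd
  refine ⟨β, hβ, ?_⟩
  have happrox : ∀ ε > 0, ∃ q : ℤ × ℤ, q.1 < q.2 ∧ ∀ᶠ p in windowFilter,
      windowAverage p (fun m => ‖windowAverage q (fun k => U k (g m)) - P (g m)‖ ^ 2) ≤ ε := by
    intro ε hε
    obtain ⟨K, hK⟩ := eventually_windowFilter.1
      ((hβ.eventually (eventually_le_nhds (show β < β + ε / 2 by linarith))).and
        eventually_lt_windowFilter)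
    have hq := (hK (0, K) (by simp)).2
    refine ⟨(0, K), hq, ?_⟩
    set q : ℤ × ℤ := (0, K) with hqdef
    set A : ℤ →₀ ℝ := windowAverage q (fun k => Finsupp.single k 1) with hA
    have hGA : ∀ m, G m A = windowAverage q (fun k => U k (g m)) := fun m => by
      simp [hA, LinearMap.map_windowAverage, hG]
    have hBA : B A A ≤ β + ε / 2 := by
      rw [hA, windowAverage_map_windowAverage, ← windowAverage_const hq (β + ε / 2)]
      refine windowAverage_mono q fun k => ?_
      simp only [hBe, sub_eq_add_neg]
      rw [windowAverage_comp_add]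
      exact (hK (q.1 + -k, q.2 + -k) (by simp [hqdef])).1
    have hsq : ∀ m, ‖windowAverage q (fun k => U k (g m)) - P (g m)‖ ^ 2 =
        ⟪G m A, G m A⟫ - b m := by
      intro m
      have h1 : ⟪windowAverage q (fun k => U k (g m)), P (g m)⟫ = b m := by
        rw [real_inner_comm]
        have h2 := LinearMap.map_windowAverage q (innerₗ H (P (g m))) (fun k => U k (g m))
        simp only [innerₗ_apply_apply] at h2
        rw [h2, ← windowAverage_const hq (b m)]
        congr 1
        funext k
        rw [← hPg, real_inner_comm, ← (U k).inner_map_map (g m), hPfix]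
      rw [norm_sub_sq_real, h1, hGA, real_inner_self_eq_norm_sq, hb]
      ring
    simp only [hsq, windowAverage_sub]
    exact ((hGB A A).sub hβ).eventually (eventually_le_nhds (by linarith))
  have hdiff : Tendsto (fun p => windowAverage p (fun n => windowAverage p
      (fun m => ⟪g m, U n (g m)⟫)) - windowAverage p b) windowFilter (𝓝 0) := by
    refine Metric.tendsto_nhds.2 fun η hη => ?_
    obtain ⟨q, hq, hqp⟩ := happrox ((η / 4) ^ 2) (by positivity)
    set c := windowAverage q (fun k => (k.natAbs : ℝ)) with hc
    have hc0 : 0 ≤ c := windowAverage_nonneg q fun k => Nat.cast_nonneg _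
    have hsmall : ∀ᶠ p : ℤ × ℤ in windowFilter, c * (2 * ((p.2 : ℝ) - p.1)⁻¹) < η / 4 := by
      have := (tendsto_inv_length.const_mul 2).const_mul c
      rw [mul_zero, mul_zero] at this
      exact this.eventually (eventually_lt_nhds (by linarith))
    filter_upwards [hqp, hsmall, eventually_lt_windowFilter] with p h1 h2 hp
    rw [dist_zero_right, windowAverage_comm, ← windowAverage_sub]
    have h3 : ∀ m, ‖windowAverage p (fun n => ⟪g m, U n (g m)⟫) - b m‖ ≤
        (η / 4)⁻¹ * ‖windowAverage q (fun k => U k (g m)) - P (g m)‖ ^ 2 + η / 2 := by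
      intro m
      have h4 : windowAverage p (fun n => ⟪g m, U n (g m)⟫) - b m =
          ⟪g m, windowAverage p (fun n => U n (g m)) - P (g m)⟫ := by
        rw [inner_sub_right, hPg]
        congr 1
        exact (LinearMap.map_windowAverage p (innerₗ H (g m)) _).symm
      have h5 := norm_windowAverage_orbit_sub_le hadd hp hq (g m) (P (g m)) fun n => hPfix n _
      have h6 : c * (2 * ‖g m‖ * ((p.2 : ℝ) - p.1)⁻¹) ≤ c * (2 * ((p.2 : ℝ) - p.1)⁻¹) := by
        refine mul_le_mul_of_nonneg_left ?_ hc0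
        refine mul_le_mul_of_nonneg_right ?_ (inv_length_nonneg p hp.le)
        linarith [hg m]
      set t := ‖windowAverage q (fun k => U k (g m)) - P (g m)‖ with ht
      have h7 : t ≤ (η / 4)⁻¹ * t ^ 2 + η / 4 := by
        have h8 : 0 < η / 4 := by linarith
        have h9 : t * (η / 4) ≤ t ^ 2 + (η / 4) ^ 2 := by nlinarith [sq_nonneg (t - η / 4)]
        calc t = (η / 4)⁻¹ * (t * (η / 4)) := by field_simp
          _ ≤ (η / 4)⁻¹ * (t ^ 2 + (η / 4) ^ 2) :=
            mul_le_mul_of_nonneg_left h9 (inv_nonneg.2 h8.le)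
          _ = (η / 4)⁻¹ * t ^ 2 + η / 4 := by field_simp
      rw [h4]
      have h10 := norm_inner_le_norm (𝕜 := ℝ) (g m)
        (windowAverage p (fun n => U n (g m)) - P (g m))
      have h11 := mul_le_mul_of_nonneg_right (hg m)
        (norm_nonneg (windowAverage p (fun n => U n (g m)) - P (g m)))
      linarith
    have h12 := (norm_windowAverage_le p _).trans (windowAverage_mono p h3)
    rw [windowAverage_add, windowAverage_const hp, windowAverage_const_mul] at h12
    have h13 : (η / 4)⁻¹ * windowAverage p
        (fun m => ‖windowAverage q (fun k => U k (g m)) - P (g m)‖ ^ 2) ≤ η / 4 := by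
      refine (mul_le_mul_of_nonneg_left h1 (by positivity)).trans (le_of_eq ?_)
      field_simp
    linarith
  simpa using hdiff.add hβ

theorem inner_pow_four_le_of_tendsto_windowAverage {U : ℤ → H →ₗᵢ[ℝ] H} {P : H → H}
    (hP : ∀ x, Tendsto (fun p => windowAverage p (fun n => U n x)) windowFilter (𝓝 (P x)))
    (hPfix : ∀ n x, U n (P x) = P x) (hPinner : ∀ x y, (∀ n, U n y = y) → ⟪P x, y⟫ = ⟪x, y⟫)
    {g : ℤ → H} {x v : H} (hv : ∀ n, U n v = v) (hv1 : ‖v‖ ≤ 1)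
    (hgx : ∀ n, ⟪g n, v⟫ = ⟪x, U n x⟫) {β : ℝ}
    (hβ : Tendsto (fun p => windowAverage p (fun m => ‖P (g m)‖ ^ 2)) windowFilter (𝓝 β)) :
    ⟪x, v⟫ ^ 4 ≤ β := by
  have hle : ∀ y, ⟪y, v⟫ ^ 2 ≤ ‖P y‖ ^ 2 := by
    intro y
    rw [← hPinner y v hv, sq_le_sq, abs_norm]
    exact (abs_real_inner_le_norm _ _).trans (mul_le_of_le_one_right (norm_nonneg _) hv1)
  set w := ‖P x‖ ^ 2 with hw
  have h1 : Tendsto (fun p => windowAverage p (fun n => ⟪x, U n x⟫)) windowFilter (𝓝 w) := by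
    have h2 := (tendsto_const_nhds (x := x)).inner (𝕜 := ℝ) (hP x)
    rw [← hPinner _ _ fun n => hPfix n _, real_inner_self_eq_norm_sq] at h2
    exact h2.congr fun p => LinearMap.map_windowAverage p (innerₗ H x) _
  have h3 : 2 * w * w - w ^ 2 ≤ β := by
    refine le_of_tendsto_of_tendsto ((h1.const_mul (2 * w)).sub_const (w ^ 2)) hβ
      (eventually_lt_windowFilter.mono fun p hp => ?_)
    dsimp only
    rw [← windowAverage_const_mul]
    conv_lhs => rw [← windowAverage_const hp (w ^ 2)]
    rw [← windowAverage_sub]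
    refine windowAverage_mono p fun n => ?_
    have := hle (g n)
    rw [hgx] at this
    nlinarith [sq_nonneg (⟪x, U n x⟫ - w)]
  have h4 : (⟪x, v⟫ ^ 2) ^ 2 ≤ w ^ 2 := pow_le_pow_left₀ (sq_nonneg _) (hle x) 2
  calc ⟪x, v⟫ ^ 4 = (⟪x, v⟫ ^ 2) ^ 2 := by ring
    _ ≤ β := by linarith

end Hilbert

/-- For an invertible measure-preserving transformation (modeled as a
measure-preserving `ℤ`-action, so that `TⁿA = (T⁻ⁿ)⁻¹A`) of a probability space and any
set `A` of positive measure, the averages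
`(1/(N−M)²) Σ_{n,m=M}^{N-1} μ(A ∩ TⁿA ∩ TᵐA ∩ T^{n+m}A)` converge as `N − M → ∞` and the
limit is at least `μ(A)⁴`. -/
theorem double_average_recurrence
    {X : Type*} [MeasurableSpace X] (μ : Measure X) [IsProbabilityMeasure μ]
    (T : ℤ → X → X)
    (hT : ∀ n : ℤ, MeasurePreserving (T n) μ μ)
    (hT0 : T 0 = id)
    (hTadd : ∀ n m : ℤ, T (n + m) = T n ∘ T m)
    (A : Set X) (hA : MeasurableSet A) (hApos : 0 < μ A) :
    ∃ L : ℝ, (μ A).toReal ^ 4 ≤ L ∧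
      ∀ ε : ℝ, 0 < ε → ∃ K : ℕ, ∀ M N : ℤ, (K : ℤ) ≤ N - M →
        |(1 / ((N : ℝ) - (M : ℝ)) ^ 2) *
            ∑ n ∈ Finset.Ico M N, ∑ m ∈ Finset.Ico M N,
              (μ (A ∩ T (-n) ⁻¹' A ∩ T (-m) ⁻¹' A ∩ T (-(n + m)) ⁻¹' A)).toReal
          - L| < ε := by
  set F : ∀ S : Set X, MeasurableSet S → Lp ℝ 2 μ :=
    fun S hS => indicatorConstLp 2 hS (measure_ne_top μ S) (1 : ℝ) with hF
  set U : ℤ → Lp ℝ 2 μ →ₗᵢ[ℝ] Lp ℝ 2 μ :=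
    fun n => Lp.compMeasurePreservingₗᵢ ℝ (T (-n)) (hT (-n)) with hU
  have hcongr : ∀ (f f' : X → X) (hf : MeasurePreserving f μ μ) (hf' : MeasurePreserving f' μ μ)
      (x : Lp ℝ 2 μ), f = f' → Lp.compMeasurePreserving f hf x =
        Lp.compMeasurePreserving f' hf' x := by
    rintro f _ hf hf' x rfl
    rfl
  have h0 : ∀ x, U 0 x = x := fun x =>
    (hcongr _ id (hT (-0)) (MeasurePreserving.id μ) x (by simpa using hT0)).trans (by simp)
  have hadd : ∀ n m x, U (n + m) x = U n (U m x) := fun n m x =>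
    (hcongr _ _ (hT (-(n + m))) ((hT (-m)).comp (hT (-n))) x
      (by rw [← hTadd]; congr 1; ring)).trans (Lp.compMeasurePreserving_comp_apply _ _ _)
  have hpre : ∀ n S, MeasurableSet S → MeasurableSet (T (-n) ⁻¹' S) := fun n S hS =>
    (hT (-n)).measurable hS
  have hUF : ∀ n S (hS : MeasurableSet S), U n (F S hS) = F (T (-n) ⁻¹' S) (hpre n S hS) :=
    fun n S hS => rfl
  have hinner : ∀ S S' (hS : MeasurableSet S) (hS' : MeasurableSet S'),
      ⟪F S hS, F S' hS'⟫ = μ.real (S ∩ S') := fun S S' hS hS' =>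
    L2.real_inner_indicatorConstLp_one_indicatorConstLp_one hS hS'
  have hnorm : ∀ S hS, ‖F S hS‖ ≤ 1 := fun S hS => by
    rw [← abs_norm, ← sq_le_one_iff_abs_le_one, ← real_inner_self_eq_norm_sq, hinner]
    exact measureReal_le_one
  set g : ℤ → Lp ℝ 2 μ := fun m => F (A ∩ T (-m) ⁻¹' A) (hA.inter (hpre m A hA)) with hg
  have hcorr : ∀ n m, ⟪g m, U n (g m)⟫ =
      (μ (A ∩ T (-n) ⁻¹' A ∩ T (-m) ⁻¹' A ∩ T (-(n + m)) ⁻¹' A)).toReal := by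
    intro n m
    rw [hg, hUF, hinner, measureReal_def, Set.preimage_inter, ← Set.preimage_comp, ← hTadd,
      show -m + -n = -(n + m) by ring]
    congr 2
    ext x
    simp only [Set.mem_inter_iff]
    tauto
  obtain ⟨P, hP, hPfix, hPinner⟩ := exists_invariant_projection h0 hadd
  obtain ⟨β, hβ, hlim⟩ := exists_tendsto_double_windowAverage hadd hP hPfix hPinner
    (g := g) (fun m => hnorm _ _) fun n m => by
      rw [hcorr, hcorr, add_comm m n]
      congr 2
      ext x
      simp only [Set.mem_inter_iff]
      tauto
  refine ⟨β, ?_, fun ε hε => ?_⟩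
  · have h1 := inner_pow_four_le_of_tendsto_windowAverage hP hPfix hPinner (x := F A hA)
      (v := F Set.univ MeasurableSet.univ) (fun n => rfl) (hnorm _ _)
      (fun n => by rw [hUF, hg, hinner, hinner, Set.inter_univ]) hβ
    rwa [hinner, Set.inter_univ] at h1
  · obtain ⟨K, hK⟩ := eventually_windowFilter.1 (Metric.tendsto_nhds.1 hlim ε hε)
    refine ⟨K, fun M N hMN => ?_⟩
    have h1 := hK (M, N) hMN
    rw [Real.dist_eq] at h1
    convert h1 using 3
    simp only [windowAverage, hcorr, smul_eq_mul, ← Finset.mul_sum]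
    rw [← mul_assoc, one_div, sq, mul_inv]
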